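/- arXiv:2108.06584 — 4 statements merged into one kernel-verified Lean document; each statement's English description precedes it below -/
import Mathlib

section
/- Fix an integer K ≥ 1, positive reals x_1,…,x_K, N_0 > 0, efficiencies η_1,…,η_K ∈ (0,1), saturation levels P_{H1},…,P_{HK} > 0, and a dual price λ > 0. Assume the ordering P_{H1}/(N_0·η_1·x_1) < P_{H2}/(N_0·η_2·x_2) < … < P_{HK}/(N_0·η_K·x_K). Suppose there exist an index s ∈ {1,…,K}, ρ ∈ (0,1) and C > 1 satisfying the two equations C·log C − C + 1 = ρ·P_{Hs}·x_s + B_{s−1} and λ·C = A_s + (1−ρ)·N_0·η_s·x_s², where A_s = Σ_{m=s+1}^{K} N_0·η_m·x_m² and B_s = Σ_{n=1}^{s} P_{Hn}·x_n. Define p* = P_{Hs}/(N_0·η_s·x_s), τ_0* = (1 + (p*·A_s + B_s)/(C−1))^{−1}, τ_k* = p*·N_0·η_k·x_k²·τ_0*/(C−1) for k > s, and τ_k* = P_{Hk}·x_k·τ_0*/(C−1) for k ≤ s. Then (p*, τ_0*, τ_1*,…,τ_K*) is a feasible allocation and maximizes the per-epoch Lagrangian L(p, τ_0, τ) = Σ_{k=1}^{K}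 r_k(p,τ_0,τ_k) − λ·p·τ_0 over all feasible allocations (p, τ_0, τ_1,…,τ_K), where a feasible allocation has p ≥ 0, τ_0 ≥ 0, τ_k ≥ 0 and τ_0 + Σ_{k=1}^{K} τ_k = 1. -/
/-- Rate of user `k` in the piece-wise linear EH model:
`r_k(p, τ0, τk) = τk * log(1 + (x_k/τk) * min(N0 η_k x_k p, P_{Hk}) * τ0)` for `τk > 0`,
and `0` for `τk ≤ 0`. -/
noncomputable def ehRate (x η PH : ℕ → ℝ) (N0 : ℝ) (k : ℕ) (p τ0 τk : ℝ) : ℝ :=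
  if 0 < τk then τk * Real.log (1 + (x k / τk) * min (N0 * η k * x k * p) (PH k) * τ0) else 0

lemma sum_split_mid (f : ℕ → ℝ) (K s : ℕ) (h1 : 1 ≤ s) (h2 : s ≤ K) :
    ∑ k ∈ Finset.Icc 1 K, f k =
      ∑ k ∈ Finset.Icc 1 (s - 1), f k + f s + ∑ k ∈ Finset.Icc (s + 1) K, f k := by
  have e1 : Finset.Icc 1 K = Finset.Icc 1 s ∪ Finset.Icc (s + 1) K := by
    ext k; simp only [Finset.mem_union, Finset.mem_Icc]; omega
  have e2 : Finset.Icc 1 s = insert s (Finset.Icc 1 (s - 1)) := by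
    ext k; simp only [Finset.mem_insert, Finset.mem_Icc]; omega
  rw [e1, Finset.sum_union, e2, Finset.sum_insert]
  · ring
  · simp only [Finset.mem_Icc]; omega
  · rw [Finset.disjoint_left]; intro k; simp only [Finset.mem_Icc]; omega

lemma ehRate_le (x η PH : ℕ → ℝ) (N0 : ℝ) (k : ℕ) (p τ0 t C : ℝ) (hC : 1 < C)
    (hm : 0 ≤ x k * min (N0 * η k * x k * p) (PH k)) (h0 : 0 ≤ τ0) (ht : 0 ≤ t) :
    ehRate x η PH N0 k p τ0 t ≤ t * (Real.log C - 1 + 1 / C)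
      + x k * min (N0 * η k * x k * p) (PH k) * τ0 / C := by
  unfold ehRate
  have hC0 : 0 < C := by linarith
  split_ifs with h
  · have e : x k / t * min (N0 * η k * x k * p) (PH k) * τ0
        = (x k * min (N0 * η k * x k * p) (PH k) * τ0) / t := by ring
    rw [e]
    set w := x k * min (N0 * η k * x k * p) (PH k) * τ0 with hw
    have hw0 : 0 ≤ w := mul_nonneg hm h0
    have hz : 0 < 1 + w / t := by positivity
    have hl := Real.log_le_sub_one_of_pos (div_pos hz hC0)
    rw [Real.log_div hz.ne' hC0.ne'] at hl
    have : t * Real.log (1 + w / t) ≤ t * (Real.log C + ((1 + w / t) / C - 1)) :=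
      mul_le_mul_of_nonneg_left (by linarith) h.le
    refine this.trans (le_of_eq ?_)
    field_simp
    ring
  · have : t = 0 := by linarith
    rw [this]
    have : 0 ≤ x k * min (N0 * η k * x k * p) (PH k) * τ0 / C := by positivity
    linarith

theorem theorem1_unconstrained_power
    (K : ℕ) (hK : 1 ≤ K)
    (x η PH : ℕ → ℝ) (N0 lam : ℝ)
    (hx : ∀ k ∈ Finset.Icc 1 K, 0 < x k)
    (hN0 : 0 < N0)
    (hη : ∀ k ∈ Finset.Icc 1 K, 0 < η k ∧ η k < 1)
    (hPH : ∀ k ∈ Finset.Icc 1 K, 0 < PH k)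
    (hlam : 0 < lam)
    (horder : ∀ j ∈ Finset.Icc 1 K, ∀ k ∈ Finset.Icc 1 K, j < k →
      PH j / (N0 * η j * x j) < PH k / (N0 * η k * x k))
    (A B : ℕ → ℝ)
    (hA : ∀ t, A t = ∑ m ∈ Finset.Icc (t + 1) K, N0 * η m * x m ^ 2)
    (hB : ∀ t, B t = ∑ n ∈ Finset.Icc 1 t, PH n * x n)
    (s : ℕ) (hs : s ∈ Finset.Icc 1 K)
    (ρ C : ℝ) (hρ0 : 0 < ρ) (hρ1 : ρ < 1) (hC : 1 < C)
    (heq1 : C * Real.log C - C + 1 = ρ * PH s * x s + B (s - 1))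
    (heq2 : lam * C = A s + (1 - ρ) * N0 * η s * x s ^ 2)
    (pstar τ0star : ℝ) (τstar : ℕ → ℝ)
    (hpstar : pstar = PH s / (N0 * η s * x s))
    (hτ0star : τ0star = (1 + (pstar * A s + B s) / (C - 1))⁻¹)
    (hτstar : ∀ k, τstar k =
      if k ≤ s then PH k * x k * τ0star / (C - 1)
      else pstar * N0 * η k * x k ^ 2 * τ0star / (C - 1)) :
    (0 ≤ pstar ∧ 0 ≤ τ0star ∧ (∀ k ∈ Finset.Icc 1 K, 0 ≤ τstar k) ∧
      τ0star + ∑ k ∈ Finset.Icc 1 K, τstar k = 1) ∧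
    ∀ (p τ0 : ℝ) (τ : ℕ → ℝ),
      0 ≤ p → 0 ≤ τ0 → (∀ k ∈ Finset.Icc 1 K, 0 ≤ τ k) →
      τ0 + ∑ k ∈ Finset.Icc 1 K, τ k = 1 →
      (∑ k ∈ Finset.Icc 1 K, ehRate x η PH N0 k p τ0 (τ k)) - lam * p * τ0 ≤
      (∑ k ∈ Finset.Icc 1 K, ehRate x η PH N0 k pstar τ0star (τstar k))
        - lam * pstar * τ0star := by
  rw [Finset.mem_Icc] at hs
  obtain ⟨hs1, hsK⟩ := hs
  have hC0 : 0 < C := by linarith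
  have hC1 : 0 < C - 1 := by linarith
  have hc : ∀ k ∈ Finset.Icc 1 K, 0 < N0 * η k * x k := fun k hk =>
    mul_pos (mul_pos hN0 (hη k hk).1) (hx k hk)
  have hsm : s ∈ Finset.Icc 1 K := Finset.mem_Icc.2 ⟨hs1, hsK⟩
  have hp : 0 < pstar := by rw [hpstar]; exact div_pos (hPH s hsm) (hc s hsm)
  have hps : N0 * η s * x s * pstar = PH s := by
    rw [hpstar]; exact mul_div_cancel₀ _ (hc s hsm).ne'
  have hpa : pstar * (N0 * η s * x s ^ 2) = PH s * x s := by rw [← hps]; ring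
  -- linear majorant of harvested SNR
  obtain ⟨G, hG⟩ : ∃ G : ℕ → ℝ → ℝ, ∀ k p, G k p =
      if k < s then PH k * x k else if k = s then
        ρ * PH s * x s + (1 - ρ) * N0 * η s * x s ^ 2 * p else N0 * η k * x k ^ 2 * p :=
    ⟨_, fun _ _ => rfl⟩
  have hGsum : ∀ p, ∑ k ∈ Finset.Icc 1 K, G k p =
      C * Real.log C - C + 1 + lam * C * p := by
    intro p
    rw [sum_split_mid _ K s hs1 hsK]
    have a1 : ∑ k ∈ Finset.Icc 1 (s - 1), G k p = B (s - 1) := by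
      rw [hB]
      refine Finset.sum_congr rfl fun k hk => ?_
      rw [Finset.mem_Icc] at hk
      rw [hG, if_pos (by omega)]
    have a2 : ∑ k ∈ Finset.Icc (s + 1) K, G k p = A s * p := by
      rw [hA, Finset.sum_mul]
      refine Finset.sum_congr rfl fun k hk => ?_
      rw [Finset.mem_Icc] at hk
      rw [hG, if_neg (by omega), if_neg (by omega)]
    rw [a1, a2, heq1, heq2, hG, if_neg (lt_irrefl s), if_pos rfl]
    ring
  have hBs : B s = B (s - 1) + PH s * x s := by
    rw [hB, hB]
    obtain ⟨t, rfl⟩ : ∃ t, s = t + 1 := ⟨s - 1, by omega⟩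
    rw [Finset.sum_Icc_succ_top (by omega)]
    simp
  have hGle : ∀ k ∈ Finset.Icc 1 K, ∀ p,
      x k * min (N0 * η k * x k * p) (PH k) ≤ G k p := by
    intro k hk p
    have hxk := (hx k hk).le
    have m1 := mul_le_mul_of_nonneg_left (min_le_left (N0 * η k * x k * p) (PH k)) hxk
    have m2 := mul_le_mul_of_nonneg_left (min_le_right (N0 * η k * x k * p) (PH k)) hxk
    rw [hG]
    split_ifs with h1 h2
    · linarith
    · subst h2
      have := mul_le_mul_of_nonneg_left m1 (by linarith : 0 ≤ 1 - ρ)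
      have := mul_le_mul_of_nonneg_left m2 hρ0.le
      linarith
    · linarith
  have hGeq : ∀ k ∈ Finset.Icc 1 K,
      x k * min (N0 * η k * x k * pstar) (PH k) = G k pstar := by
    intro k hk
    rw [hG]
    split_ifs with h1 h2
    · have := horder k hk s hsm h1
      rw [← hpstar, div_lt_iff₀ (hc k hk)] at this
      rw [min_eq_right (by linarith)]; ring
    · subst h2
      rw [hps, min_self]; linear_combination -(1 - ρ) * hpa
    · have := horder s hsm k hk (by omega)
      rw [← hpstar, lt_div_iff₀ (hc k hk)] at this
      rw [min_eq_left (by linarith)]; ring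
  have hGpos : ∀ k ∈ Finset.Icc 1 K, 0 < G k pstar := by
    intro k hk
    rw [← hGeq k hk]
    exact mul_pos (hx k hk) (lt_min (mul_pos (hc k hk) hp) (hPH k hk))
  have hτG : ∀ k, τstar k = G k pstar * τ0star / (C - 1) := by
    intro k
    rw [hτstar, hG]
    rcases lt_trichotomy k s with h | h | h
    · rw [if_pos h.le, if_pos h]
    · subst h
      rw [if_pos le_rfl, if_neg (lt_irrefl k), if_pos rfl]
      congr 2
      linear_combination -(1 - ρ) * hpa
    · rw [if_neg (by omega), if_neg (by omega), if_neg (by omega)]; ring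
  have hS : ∑ k ∈ Finset.Icc 1 K, G k pstar = pstar * A s + B s := by
    rw [hGsum, heq1, heq2, hBs]; linear_combination (1 - ρ) * hpa
  have hSnn : 0 ≤ pstar * A s + B s := by
    rw [← hS]; exact Finset.sum_nonneg fun k hk => (hGpos k hk).le
  have hden : 0 < 1 + (pstar * A s + B s) / (C - 1) := by positivity
  have hτ0 : 0 < τ0star := by rw [hτ0star]; exact inv_pos.2 hden
  have hτpos : ∀ k ∈ Finset.Icc 1 K, 0 < τstar k := fun k hk => by
    rw [hτG]; exact div_pos (mul_pos (hGpos k hk) hτ0) hC1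
  have hnorm : τ0star * (1 + (pstar * A s + B s) / (C - 1)) = 1 := by
    rw [hτ0star]; exact inv_mul_cancel₀ hden.ne'
  have hsum : τ0star + ∑ k ∈ Finset.Icc 1 K, τstar k = 1 := by
    simp_rw [hτG]
    rw [← Finset.sum_div, ← Finset.sum_mul, hS]; linear_combination hnorm
  refine ⟨⟨hp.le, hτ0.le, fun k hk => (hτpos k hk).le, hsum⟩, ?_⟩
  intro p τ0 τ hp0 h0 hτn hτs
  have upper : ∑ k ∈ Finset.Icc 1 K, ehRate x η PH N0 k p τ0 (τ k) ≤
      (∑ k ∈ Finset.Icc 1 K, τ k) * (Real.log C - 1 + 1 / C)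
        + (∑ k ∈ Finset.Icc 1 K, G k p) * τ0 / C := by
    rw [Finset.sum_mul, Finset.sum_mul, Finset.sum_div, ← Finset.sum_add_distrib]
    refine Finset.sum_le_sum fun k hk => ?_
    refine (ehRate_le x η PH N0 k p τ0 (τ k) C hC ?_ h0 (hτn k hk)).trans ?_
    · exact mul_nonneg (hx k hk).le (le_min (mul_nonneg (hc k hk).le hp0) (hPH k hk).le)
    · have := hGle k hk p
      gcongr
  have upper2 : (∑ k ∈ Finset.Icc 1 K, τ k) * (Real.log C - 1 + 1 / C)
        + (∑ k ∈ Finset.Icc 1 K, G k p) * τ0 / C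
        = Real.log C - 1 + 1 / C + lam * p * τ0 := by
    have e : ∑ k ∈ Finset.Icc 1 K, τ k = 1 - τ0 := by linarith
    rw [e, hGsum]
    field_simp
    ring
  have attained : ∑ k ∈ Finset.Icc 1 K, ehRate x η PH N0 k pstar τ0star (τstar k)
      = (1 - τ0star) * Real.log C := by
    have e : ∑ k ∈ Finset.Icc 1 K, τstar k = 1 - τ0star := by linarith
    rw [← e, Finset.sum_mul]
    refine Finset.sum_congr rfl fun k hk => ?_
    unfold ehRate
    rw [if_pos (hτpos k hk)]
    have e2 : x k / τstar k * min (N0 * η k * x k * pstar) (PH k) * τ0star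
        = G k pstar * τ0star / τstar k := by rw [← hGeq k hk]; ring
    have e3 : G k pstar * τ0star / τstar k = C - 1 := by
      rw [div_eq_iff (hτpos k hk).ne', hτG]; field_simp
    rw [e2, e3]; congr 2; ring
  have key : τ0star * (C * Real.log C + lam * C * pstar) = C - 1 := by
    have h1 : C * Real.log C + lam * C * pstar = C - 1 + (pstar * A s + B s) := by
      rw [← hS, hGsum]; ring
    have h2 : C - 1 + (pstar * A s + B s)
        = (C - 1) * (1 + (pstar * A s + B s) / (C - 1)) := by field_simp
    rw [h1, h2]; linear_combination (C - 1) * hnorm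
  have key2 : τ0star * (Real.log C + lam * pstar) = 1 - 1 / C := by
    field_simp
    linear_combination key
  rw [attained]
  linarith
end

section
/- Fix an integer K ≥ 1, positive reals x_1,…,x_K, N_0 > 0, efficiencies η_1,…,η_K ∈ (0,1), saturation levels P_{H1},…,P_{HK} > 0, a dual price λ > 0, and a peak power P_M > 0. Assume there is an index g ∈ {1,…,K} with P_{Hk}/(N_0·η_k·x_k) < P_M for all k ≤ g and P_M < P_{Hk}/(N_0·η_k·x_k) for all k > g, and assume the ordering P_{H1}/(N_0·η_1·x_1) < … < P_{HK}/(N_0·η_K·x_K). Let C > 1 satisfy C·log C − C + 1 + λ·P_M·C = P_M·A_g + B_g, where A_g = Σ_{m=g+1}^{K} N_0·η_m·x_m² and B_g = Σ_{n=1}^{g} P_{Hn}·x_n, and assume additionally A_g ≥ λ·C. Define p* = P_M, τ_0* = (1 + (P_M·A_g + B_g)/(C−1))^{−1}, τ_k* = P_M·N_0·η_k·x_k²·τ_0*/(C−1) for k > g, and τ_k* = P_{Hk}·x_k·τ_0*/(C−1) for k ≤ g. Then (p*, τ_0*, τ_1*,…,τ_K*) is feasible and maximizes the per-epoch Lagrangian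 L(p, τ_0, τ) = Σ_{k=1}^{K} r_k(p,τ_0,τ_k) − λ·p·τ_0 over all allocations with 0 ≤ p ≤ P_M, τ_0 ≥ 0, τ_k ≥ 0 and τ_0 + Σ_{k=1}^{K} τ_k = 1. -/
lemma ehRate_le_tangent (x η PH : ℕ → ℝ) (N0 : ℝ) (k : ℕ) (p τ0 t C : ℝ) (hC : 1 < C)
    (ht : 0 ≤ t) (hs : 0 ≤ x k * min (N0 * η k * x k * p) (PH k) * τ0) :
    ehRate x η PH N0 k p τ0 t ≤
      t * (Real.log C - 1 + 1 / C) + x k * min (N0 * η k * x k * p) (PH k) * τ0 / C := by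
  have hC0 : 0 < C := by linarith
  unfold ehRate
  split_ifs with h
  · set s := x k * min (N0 * η k * x k * p) (PH k) * τ0 with hsdef
    have e : 1 + (x k / t) * min (N0 * η k * x k * p) (PH k) * τ0 = 1 + s / t := by
      rw [hsdef]; ring
    rw [e]
    have hy : 0 < 1 + s / t := by positivity
    have h1 := Real.log_le_sub_one_of_pos (div_pos hy hC0)
    rw [Real.log_div hy.ne' hC0.ne'] at h1
    have h2 : t * Real.log (1 + s / t) ≤ t * (Real.log C + ((1 + s / t) / C - 1)) :=
      mul_le_mul_of_nonneg_left (by linarith) ht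
    refine h2.trans (le_of_eq ?_)
    field_simp
    ring
  · have : t = 0 := le_antisymm (not_lt.mp h) ht
    subst this
    have := div_nonneg hs hC0.le
    linarith

lemma sum_split_Icc (f h : ℕ → ℝ) (g K : ℕ) (hgK : g ≤ K) :
    ∑ k ∈ Finset.Icc 1 K, (if k ≤ g then f k else h k) =
      ∑ k ∈ Finset.Icc 1 g, f k + ∑ k ∈ Finset.Icc (g + 1) K, h k := by
  rw [Finset.sum_ite]
  congr 1
  · apply Finset.sum_congr _ (fun _ _ => rfl)
    ext k; simp only [Finset.mem_filter, Finset.mem_Icc]; omega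
  · apply Finset.sum_congr _ (fun _ _ => rfl)
    ext k; simp only [Finset.mem_filter, Finset.mem_Icc]; omega

theorem theorem2_peak_constrained_power
    (K : ℕ) (hK : 1 ≤ K)
    (x η PH : ℕ → ℝ) (N0 lam PM : ℝ)
    (hx : ∀ k ∈ Finset.Icc 1 K, 0 < x k)
    (hN0 : 0 < N0)
    (hη : ∀ k ∈ Finset.Icc 1 K, 0 < η k ∧ η k < 1)
    (hPH : ∀ k ∈ Finset.Icc 1 K, 0 < PH k)
    (hlam : 0 < lam) (hPM : 0 < PM)
    (horder : ∀ j ∈ Finset.Icc 1 K, ∀ k ∈ Finset.Icc 1 K, j < k →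
      PH j / (N0 * η j * x j) < PH k / (N0 * η k * x k))
    (g : ℕ) (hg : g ∈ Finset.Icc 1 K)
    (hgbelow : ∀ k ∈ Finset.Icc 1 K, k ≤ g → PH k / (N0 * η k * x k) < PM)
    (hgabove : ∀ k ∈ Finset.Icc 1 K, g < k → PM < PH k / (N0 * η k * x k))
    (A B : ℕ → ℝ)
    (hA : ∀ t, A t = ∑ m ∈ Finset.Icc (t + 1) K, N0 * η m * x m ^ 2)
    (hB : ∀ t, B t = ∑ n ∈ Finset.Icc 1 t, PH n * x n)
    (C : ℝ) (hC : 1 < C)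
    (heqC : C * Real.log C - C + 1 + lam * PM * C = PM * A g + B g)
    (hmult : lam * C ≤ A g)
    (pstar τ0star : ℝ) (τstar : ℕ → ℝ)
    (hpstar : pstar = PM)
    (hτ0star : τ0star = (1 + (PM * A g + B g) / (C - 1))⁻¹)
    (hτstar : ∀ k, τstar k =
      if k ≤ g then PH k * x k * τ0star / (C - 1)
      else PM * N0 * η k * x k ^ 2 * τ0star / (C - 1)) :
    (0 ≤ pstar ∧ pstar ≤ PM ∧ 0 ≤ τ0star ∧ (∀ k ∈ Finset.Icc 1 K, 0 ≤ τstar k) ∧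
      τ0star + ∑ k ∈ Finset.Icc 1 K, τstar k = 1) ∧
    ∀ (p τ0 : ℝ) (τ : ℕ → ℝ),
      0 ≤ p → p ≤ PM → 0 ≤ τ0 → (∀ k ∈ Finset.Icc 1 K, 0 ≤ τ k) →
      τ0 + ∑ k ∈ Finset.Icc 1 K, τ k = 1 →
      (∑ k ∈ Finset.Icc 1 K, ehRate x η PH N0 k p τ0 (τ k)) - lam * p * τ0 ≤
      (∑ k ∈ Finset.Icc 1 K, ehRate x η PH N0 k pstar τ0star (τstar k))
        - lam * pstar * τ0star := by
  have hgK : g ≤ K := (Finset.mem_Icc.mp hg).2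
  have hC0 : 0 < C := by linarith
  have hC1 : 0 < C - 1 := by linarith
  have hden : ∀ k ∈ Finset.Icc 1 K, 0 < N0 * η k * x k := fun k hk =>
    mul_pos (mul_pos hN0 (hη k hk).1) (hx k hk)
  have hsum : ∀ p : ℝ, ∑ k ∈ Finset.Icc 1 K,
      (if k ≤ g then PH k * x k else p * (N0 * η k * x k ^ 2)) = p * A g + B g := by
    intro p
    rw [sum_split_Icc, hA, hB, Finset.mul_sum, add_comm]
    exact hgK
  have hapos : ∀ k ∈ Finset.Icc 1 K,
      0 < (if k ≤ g then PH k * x k else PM * (N0 * η k * x k ^ 2)) := by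
    intro k hk
    have h1 := hx k hk
    have h2 := hPH k hk
    have h3 := (hη k hk).1
    split_ifs <;> positivity
  have hτ' : ∀ k, τstar k =
      (if k ≤ g then PH k * x k else PM * (N0 * η k * x k ^ 2)) * (τ0star / (C - 1)) := by
    intro k
    rw [hτstar]
    split_ifs <;> ring
  have hmin : ∀ k ∈ Finset.Icc 1 K, x k * min (N0 * η k * x k * PM) (PH k) =
      (if k ≤ g then PH k * x k else PM * (N0 * η k * x k ^ 2)) := by
    intro k hk
    split_ifs with h
    · have h1 := hgbelow k hk h
      rw [div_lt_iff₀ (hden k hk)] at h1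
      rw [min_eq_right (by linarith)]; ring
    · have h1 := hgabove k hk (not_le.mp h)
      rw [lt_div_iff₀ (hden k hk)] at h1
      rw [min_eq_left (by linarith)]; ring
  have hSpos : 0 ≤ PM * A g + B g := by
    rw [← hsum PM]; exact Finset.sum_nonneg fun k hk => (hapos k hk).le
  set S := PM * A g + B g with hS
  have hT : 0 < C - 1 + S := by linarith
  have hτ0 : τ0star = (C - 1) / (C - 1 + S) := by
    rw [hτ0star]; field_simp
  have hτ0pos : 0 < τ0star := by rw [hτ0]; positivity
  have hsumτ : ∑ k ∈ Finset.Icc 1 K, τstar k = S * (τ0star / (C - 1)) := by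
    rw [hS, ← hsum PM, Finset.sum_mul]
    exact Finset.sum_congr rfl fun k _ => hτ' k
  have hτpos : ∀ k ∈ Finset.Icc 1 K, 0 < τstar k := by
    intro k hk
    rw [hτ']
    exact mul_pos (hapos k hk) (by positivity)
  refine ⟨⟨by rw [hpstar]; exact hPM.le, hpstar.le, hτ0pos.le, fun k hk => (hτpos k hk).le, ?_⟩, ?_⟩
  · rw [hsumτ, hτ0]; field_simp
  intro p τ0 τ hp hpM hτ0nn hτnn hτsum
  have hstar : ∑ k ∈ Finset.Icc 1 K, ehRate x η PH N0 k pstar τ0star (τstar k) =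
      S * (τ0star / (C - 1)) * Real.log C := by
    rw [← hsumτ, Finset.sum_mul]
    refine Finset.sum_congr rfl fun k hk => ?_
    unfold ehRate
    rw [if_pos (hτpos k hk), hpstar]
    congr 2
    have e : x k / τstar k * min (N0 * η k * x k * PM) (PH k) * τ0star =
        (x k * min (N0 * η k * x k * PM) (PH k)) * τ0star / τstar k := by ring
    rw [e, hmin k hk, hτ']
    have hak := hapos k hk
    generalize (if k ≤ g then PH k * x k else PM * (N0 * η k * x k ^ 2)) = a at hak
    field_simp
    ring
  have hval : S * (τ0star / (C - 1)) * Real.log C - lam * pstar * τ0star =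
      Real.log C - 1 + 1 / C := by
    have h1 : lam * PM = (S - C * Real.log C + C - 1) / C := by
      rw [eq_div_iff hC0.ne']; linarith
    rw [hpstar, h1, hτ0]
    field_simp
    ring
  rw [hstar, hval]
  have hs : ∀ k ∈ Finset.Icc 1 K, 0 ≤ x k * min (N0 * η k * x k * p) (PH k) * τ0 := by
    intro k hk
    exact mul_nonneg (mul_nonneg (hx k hk).le
      (le_min (mul_nonneg (hden k hk).le hp) (hPH k hk).le)) hτ0nn
  have hb : ∑ k ∈ Finset.Icc 1 K, ehRate x η PH N0 k p τ0 (τ k) ≤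
      ∑ k ∈ Finset.Icc 1 K, (τ k * (Real.log C - 1 + 1 / C) +
        (if k ≤ g then PH k * x k else p * (N0 * η k * x k ^ 2)) * (τ0 / C)) := by
    refine Finset.sum_le_sum fun k hk => ?_
    refine (ehRate_le_tangent x η PH N0 k p τ0 (τ k) C hC (hτnn k hk) (hs k hk)).trans ?_
    have hle : x k * min (N0 * η k * x k * p) (PH k) ≤
        (if k ≤ g then PH k * x k else p * (N0 * η k * x k ^ 2)) := by
      split_ifs
      · rw [mul_comm (PH k)]
        exact mul_le_mul_of_nonneg_left (min_le_right _ _) (hx k hk).le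
      · have := mul_le_mul_of_nonneg_left
          (min_le_left (N0 * η k * x k * p) (PH k)) (hx k hk).le
        refine this.trans (le_of_eq ?_)
        ring
    have := mul_le_mul_of_nonneg_right hle (div_nonneg hτ0nn hC0.le)
    rw [mul_div_assoc]
    linarith
  rw [Finset.sum_add_distrib, ← Finset.sum_mul, ← Finset.sum_mul, hsum p] at hb
  have hτs : ∑ k ∈ Finset.Icc 1 K, τ k = 1 - τ0 := by linarith
  rw [hτs] at hb
  have hkey : p * A g + B g - lam * p * C ≤ C * (Real.log C - 1 + 1 / C) := by
    have h1 : C * (Real.log C - 1 + 1 / C) = C * Real.log C - C + 1 := by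
      field_simp
    rw [h1]
    nlinarith [mul_nonneg (sub_nonneg.mpr hpM) (sub_nonneg.mpr hmult)]
  have h2 := mul_le_mul_of_nonneg_right hkey (div_nonneg hτ0nn hC0.le)
  have h3 : C * (Real.log C - 1 + 1 / C) * (τ0 / C) = τ0 * (Real.log C - 1 + 1 / C) := by
    field_simp
  have h4 : (p * A g + B g - lam * p * C) * (τ0 / C) =
      (p * A g + B g) * (τ0 / C) - lam * p * τ0 := by
    field_simp
  rw [h3, h4] at h2
  linarith
end

section
/- Fix an integer K ≥ 1, positive reals x_1,…,x_K, N_0 > 0, efficiencies η_1,…,η_K ∈ (0,1), saturation levels P_{H1},…,P_{HK} > 0, and λ > 0. Assume Σ_{k=1}^{K} N_0·η_k·x_k² < λ. Then for every p ≥ 0 and every τ_0 ≥ 0, τ_1,…,τ_K ≥ 0 with τ_0 + Σ_{k=1}^{K} τ_k = 1, the per-epoch Lagrangian satisfies Σ_{k=1}^{K} r_k(p,τ_0,τ_k) − λ·p·τ_0 ≤ 0, with strict inequality whenever p·τ_0 > 0 and τ_k > 0 for some k. In particular, the per-epoch Lagrangian is maximized by setting p = 0. -/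
theorem ehRate_le_aux (x η PH : ℕ → ℝ) (N0 : ℝ) (k : ℕ) (p τ0 t : ℝ)
    (hx : 0 < x k) (hN0 : 0 < N0) (hη : 0 < η k) (hPH : 0 < PH k)
    (hp : 0 ≤ p) (h0 : 0 ≤ τ0) :
    ehRate x η PH N0 k p τ0 t ≤ N0 * η k * x k ^ 2 * (p * τ0) := by
  unfold ehRate
  split_ifs with ht
  · have hm0 : 0 ≤ min (N0 * η k * x k * p) (PH k) := le_min (by positivity) hPH.le
    have hm1 : min (N0 * η k * x k * p) (PH k) ≤ N0 * η k * x k * p := min_le_left _ _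
    generalize min (N0 * η k * x k * p) (PH k) = m at hm0 hm1
    have hpos : 0 < 1 + x k / t * m * τ0 := by positivity
    have hlog := Real.log_le_sub_one_of_pos hpos
    calc t * Real.log (1 + x k / t * m * τ0) ≤ t * (x k / t * m * τ0) :=
          mul_le_mul_of_nonneg_left (by linarith) ht.le
      _ = m * (x k * τ0) := by field_simp
      _ ≤ (N0 * η k * x k * p) * (x k * τ0) :=
          mul_le_mul_of_nonneg_right hm1 (by positivity)
      _ = _ := by ring
  · positivity

theorem zero_power_optimal_when_price_high
    (K : ℕ) (hK : 1 ≤ K)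
    (x η PH : ℕ → ℝ) (N0 lam : ℝ)
    (hx : ∀ k ∈ Finset.Icc 1 K, 0 < x k)
    (hN0 : 0 < N0)
    (hη : ∀ k ∈ Finset.Icc 1 K, 0 < η k ∧ η k < 1)
    (hPH : ∀ k ∈ Finset.Icc 1 K, 0 < PH k)
    (hlam : 0 < lam)
    (hsmall : ∑ k ∈ Finset.Icc 1 K, N0 * η k * x k ^ 2 < lam) :
    ∀ (p τ0 : ℝ) (τ : ℕ → ℝ),
      0 ≤ p → 0 ≤ τ0 → (∀ k ∈ Finset.Icc 1 K, 0 ≤ τ k) →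
      τ0 + ∑ k ∈ Finset.Icc 1 K, τ k = 1 →
      ((∑ k ∈ Finset.Icc 1 K, ehRate x η PH N0 k p τ0 (τ k)) - lam * p * τ0 ≤ 0) ∧
      (0 < p * τ0 → (∃ k ∈ Finset.Icc 1 K, 0 < τ k) →
        (∑ k ∈ Finset.Icc 1 K, ehRate x η PH N0 k p τ0 (τ k)) - lam * p * τ0 < 0) ∧
      (∀ (τ0' : ℝ) (τ' : ℕ → ℝ),
        0 ≤ τ0' → (∀ k ∈ Finset.Icc 1 K, 0 ≤ τ' k) →
        τ0' + ∑ k ∈ Finset.Icc 1 K, τ' k = 1 →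
        (∑ k ∈ Finset.Icc 1 K, ehRate x η PH N0 k p τ0 (τ k)) - lam * p * τ0 ≤
        (∑ k ∈ Finset.Icc 1 K, ehRate x η PH N0 k 0 τ0' (τ' k)) - lam * 0 * τ0') := by
  intro p τ0 τ hp h0 hτ hsum
  have hle : ∑ k ∈ Finset.Icc 1 K, ehRate x η PH N0 k p τ0 (τ k)
      ≤ (∑ k ∈ Finset.Icc 1 K, N0 * η k * x k ^ 2) * (p * τ0) := by
    rw [Finset.sum_mul]
    exact Finset.sum_le_sum fun k hk =>
      ehRate_le_aux x η PH N0 k p τ0 (τ k) (hx k hk) hN0 (hη k hk).1 (hPH k hk) hp h0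
  have hmain : (∑ k ∈ Finset.Icc 1 K, ehRate x η PH N0 k p τ0 (τ k)) - lam * p * τ0 ≤ 0 := by
    have := mul_le_mul_of_nonneg_right hsmall.le (mul_nonneg hp h0)
    linarith
  refine ⟨hmain, ?_, ?_⟩
  · intro hpos _
    have := mul_lt_mul_of_pos_right hsmall hpos
    linarith
  · intro τ0' τ' _ _ _
    have hz : ∑ k ∈ Finset.Icc 1 K, ehRate x η PH N0 k 0 τ0' (τ' k) = 0 := by
      refine Finset.sum_eq_zero fun k hk => ?_
      simp [ehRate, min_eq_left (hPH k hk).le]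
    rw [hz]
    linarith
end

section
/- Fix an integer K ≥ 1, positive reals x_1,…,x_K, N_0 > 0, η_1,…,η_K ∈ (0,1), P_{H1},…,P_{HK} > 0, an index s ∈ {1,…,K}, and C > 1, and assume the ordering P_{H1}/(N_0·η_1·x_1) < … < P_{HK}/(N_0·η_K·x_K). Set p = P_{Hs}/(N_0·η_s·x_s), A_s = Σ_{m=s+1}^{K} N_0·η_m·x_m², B_s = Σ_{n=1}^{s} P_{Hn}·x_n, τ_0 = (1 + (p·A_s + B_s)/(C−1))^{−1}, τ_k = p·N_0·η_k·x_k²·τ_0/(C−1) for k > s, and τ_k = P_{Hk}·x_k·τ_0/(C−1) for k ≤ s. Then for every k ∈ {1,…,K}, the received SNR of user k satisfies (x_k/τ_k)·min(N_0·η_k·x_k·p, P_{Hk})·τ_0 = C − 1. -/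
theorem equal_snr_at_optimum
    (K : ℕ) (hK : 1 ≤ K)
    (x η PH : ℕ → ℝ) (N0 : ℝ)
    (hx : ∀ k ∈ Finset.Icc 1 K, 0 < x k)
    (hN0 : 0 < N0)
    (hη : ∀ k ∈ Finset.Icc 1 K, 0 < η k ∧ η k < 1)
    (hPH : ∀ k ∈ Finset.Icc 1 K, 0 < PH k)
    (horder : ∀ j ∈ Finset.Icc 1 K, ∀ k ∈ Finset.Icc 1 K, j < k →
      PH j / (N0 * η j * x j) < PH k / (N0 * η k * x k))
    (s : ℕ) (hs : s ∈ Finset.Icc 1 K)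
    (C : ℝ) (hC : 1 < C)
    (p A B τ0 : ℝ) (τ : ℕ → ℝ)
    (hp : p = PH s / (N0 * η s * x s))
    (hA : A = ∑ m ∈ Finset.Icc (s + 1) K, N0 * η m * x m ^ 2)
    (hB : B = ∑ n ∈ Finset.Icc 1 s, PH n * x n)
    (hτ0 : τ0 = (1 + (p * A + B) / (C - 1))⁻¹)
    (hτ : ∀ k, τ k =
      if k ≤ s then PH k * x k * τ0 / (C - 1)
      else p * N0 * η k * x k ^ 2 * τ0 / (C - 1)) :
    ∀ k ∈ Finset.Icc 1 K,
      (x k / τ k) * min (N0 * η k * x k * p) (PH k) * τ0 = C - 1 := by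
  have hC' : 0 < C - 1 := by linarith
  have hsK := Finset.mem_Icc.mp hs
  have hden : ∀ k ∈ Finset.Icc 1 K, 0 < N0 * η k * x k := fun k hk =>
    mul_pos (mul_pos hN0 (hη k hk).1) (hx k hk)
  have hp0 : 0 < p := by
    rw [hp]
    exact div_pos (hPH s hs) (hden s hs)
  have hA0 : 0 ≤ A := by
    rw [hA]
    refine Finset.sum_nonneg fun m hm => ?_
    have hm' := Finset.mem_Icc.mp hm
    have h1 : m ∈ Finset.Icc 1 K := Finset.mem_Icc.mpr ⟨by omega, hm'.2⟩
    exact mul_nonneg (mul_nonneg hN0.le (hη m h1).1.le) (sq_nonneg _)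
  have hB0 : 0 ≤ B := by
    rw [hB]
    refine Finset.sum_nonneg fun m hm => ?_
    have hm' := Finset.mem_Icc.mp hm
    have h1 : m ∈ Finset.Icc 1 K := Finset.mem_Icc.mpr ⟨hm'.1, by omega⟩
    exact mul_nonneg (hPH m h1).le (hx m h1).le
  have ht : 0 < τ0 := by
    rw [hτ0]
    positivity
  clear hτ0 hA hB
  intro k hk
  have hxk := hx k hk
  have hPk := hPH k hk
  have hek := (hη k hk).1
  have hdk := hden k hk
  rw [hτ k]
  split_ifs with hks
  · have hle : PH k / (N0 * η k * x k) ≤ p := by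
      rw [hp]
      rcases hks.lt_or_eq with h | h
      · exact (horder k hk s hs h).le
      · rw [h]
    rw [div_le_iff₀ hdk] at hle
    rw [min_eq_right (by linarith)]
    field_simp
  · have hle : p < PH k / (N0 * η k * x k) := by
      rw [hp]
      exact horder s hs k hk (by omega)
    rw [lt_div_iff₀ hdk] at hle
    rw [min_eq_left (by linarith)]
    field_simp
end
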